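/- Under the (P4+kP3)-free setup, suppose that no minimum total dominating set of G contains a P3. Then every minimum total dominating set of G is an induced matching, and there exists a minimum total dominating set of G in which all but at most (k+2)(k+|A|)+|A|−1 of its matching edges are C-edges. -/

import Mathlib

open SimpleGraph

namespace TD

variable {V : Type*} {α β : Type*}

/-- `D` is a total dominating set of `G`: every vertex has a neighbor in `D`. -/
def IsTotalDomSet (G : SimpleGraph V) (D : Set V) : Prop :=
  ∀ v : V, ∃ u ∈ D, G.Adj v u

/-- The total domination number `γ_t(G)`. -/
noncomputable def totalDomNum (G : SimpleGraph V) : ℕ :=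
  sInf {m : ℕ | ∃ D : Set V, IsTotalDomSet G D ∧ D.ncard = m}

/-- A minimum total dominating set. -/
def IsMinTotalDomSet (G : SimpleGraph V) (D : Set V) : Prop :=
  IsTotalDomSet G D ∧ D.ncard = totalDomNum G

/-- `S` contains a `P3`: three distinct vertices `a, b, c ∈ S` with `ab, bc ∈ E(G)`. -/
def HasP3 (G : SimpleGraph V) (S : Set V) : Prop :=
  ∃ a b c : V, a ∈ S ∧ b ∈ S ∧ c ∈ S ∧ a ≠ b ∧ b ≠ c ∧ a ≠ c ∧ G.Adj a b ∧ G.Adj b c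

/-- `D` is a dominating set of `G`. -/
def IsDomSet (G : SimpleGraph V) (D : Set V) : Prop :=
  ∀ v ∉ D, ∃ u ∈ D, G.Adj v u

/-- The domination number `γ(G)`. -/
noncomputable def domNum (G : SimpleGraph V) : ℕ :=
  sInf {m : ℕ | ∃ D : Set V, IsDomSet G D ∧ D.ncard = m}

/-- The (open) neighborhood of a set `S`: union of the neighborhoods of its members. -/
def nbhd (G : SimpleGraph V) (S : Set V) : Set V :=
  {v | ∃ u ∈ S, G.Adj u v}

/-- The closed neighborhood `N[S]`. -/
def closedNbhd (G : SimpleGraph V) (S : Set V) : Set V :=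
  S ∪ nbhd G S

/-- Distance between two sets of vertices. -/
noncomputable def setDist (G : SimpleGraph V) (S T : Set V) : ℕ :=
  sInf {m : ℕ | ∃ u ∈ S, ∃ v ∈ T, G.dist u v = m}

/-- `k` disjoint copies of `H`. -/
def kCopies (k : ℕ) (H : SimpleGraph α) : SimpleGraph (Fin k × α) where
  Adj p q := p.1 = q.1 ∧ H.Adj p.2 q.2
  symm := ⟨fun _ _ h => ⟨h.1.symm, h.2.symm⟩⟩
  loopless := ⟨fun p h => H.loopless.irrefl p.2 h.2⟩

/-- The graph `P4 + k·P3`. -/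
def p4kp3 (k : ℕ) : SimpleGraph (Fin 4 ⊕ (Fin k × Fin 3)) :=
  (pathGraph 4) ⊕g (kCopies k (pathGraph 3))

/-- `G` contains no induced copy of `H` (`G` is `H`-free). -/
def IndFree (G : SimpleGraph V) (H : SimpleGraph α) : Prop :=
  ¬ Nonempty (H ↪g G)

/-- `K` is a maximal clique of the subgraph of `G` induced by `C`. -/
def IsMaxCliqueWithin (G : SimpleGraph V) (C K : Set V) : Prop :=
  K ⊆ C ∧ G.IsClique K ∧ ∀ K' : Set V, K' ⊆ C → G.IsClique K' → K ⊆ K' → K' = K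

/-- Member of `𝒦'`: a maximal clique of `G[C]` whose closed neighborhood contains no
induced `P4` and such that no vertex of `B` is adjacent to all of its vertices. -/
def GoodClique (G : SimpleGraph V) (B C K : Set V) : Prop :=
  IsMaxCliqueWithin G C K ∧
    IndFree (G.induce (closedNbhd G K)) (pathGraph 4) ∧
    ¬ ∃ b ∈ B, ∀ x ∈ K, G.Adj b x

/-- A regular clique: a member of `𝒦'` for which there are `k` other members of `𝒦'`
pairwise at distance at least four from one another and from it. -/
def RegularClique (G : SimpleGraph V) (k : ℕ) (B C K : Set V) : Prop :=
  GoodClique G B C K ∧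
    ∃ Ks : Fin k → Set V,
      (∀ i, GoodClique G B C (Ks i)) ∧
      (∀ i, 4 ≤ setDist G K (Ks i)) ∧
      ∀ i j : Fin k, i ≠ j → 4 ≤ setDist G (Ks i) (Ks j)

/-- `w` is a private neighbor of `v` with respect to `D`: `N(w) ∩ D = {v}`. -/
def IsPrivateNbr (G : SimpleGraph V) (D : Set V) (v w : V) : Prop :=
  {u | u ∈ D ∧ G.Adj w u} = {v}

end TD

open TD SimpleGraph

namespace TD

theorem p4kp3_adj_inl_inl {k : ℕ} {a b : Fin 4} :
    (p4kp3 k).Adj (Sum.inl a) (Sum.inl b) ↔ (pathGraph 4).Adj a b := by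
  simp [p4kp3]

theorem not_p4kp3_adj_inl_inr {k : ℕ} {a : Fin 4} {b : Fin k × Fin 3} :
    ¬ (p4kp3 k).Adj (Sum.inl a) (Sum.inr b) := by
  simp [p4kp3]

theorem not_p4kp3_adj_inr_inl {k : ℕ} {a : Fin 4} {b : Fin k × Fin 3} :
    ¬ (p4kp3 k).Adj (Sum.inr b) (Sum.inl a) := by
  simp [p4kp3]

theorem p4kp3_adj_inr_inr {k : ℕ} {a b : Fin k × Fin 3} :
    (p4kp3 k).Adj (Sum.inr a) (Sum.inr b) ↔ a.1 = b.1 ∧ (pathGraph 3).Adj a.2 b.2 := by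
  simp [p4kp3, kCopies]

theorem p4kp3_exists_adj (k : ℕ) (p : Fin 4 ⊕ (Fin k × Fin 3)) :
    ∃ q, (p4kp3 k).Adj p q := by
  rcases p with a | ⟨i, a⟩
  · fin_cases a
    · exact ⟨Sum.inl 1, by simp [p4kp3, pathGraph_adj]⟩
    · exact ⟨Sum.inl 0, by simp [p4kp3, pathGraph_adj]⟩
    · exact ⟨Sum.inl 1, by simp [p4kp3, pathGraph_adj]⟩
    · exact ⟨Sum.inl 2, by simp [p4kp3, pathGraph_adj]⟩
  · fin_cases a
    · exact ⟨Sum.inr (i, 1), by simp [p4kp3, kCopies, pathGraph_adj]⟩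
    · exact ⟨Sum.inr (i, 0), by simp [p4kp3, kCopies, pathGraph_adj]⟩
    · exact ⟨Sum.inr (i, 1), by simp [p4kp3, kCopies, pathGraph_adj]⟩

section Embedding

variable {V : Type*} {G : SimpleGraph V}

theorem exists_embedding_p4kp3_zero {a b c d : V} (hab : G.Adj a b) (hbc : G.Adj b c)
    (hcd : G.Adj c d) (hac : ¬ G.Adj a c) (had : ¬ G.Adj a d) (hbd : ¬ G.Adj b d) :
    ∃ f : p4kp3 0 ↪g G, ∀ p, f p = a ∨ f p = b ∨ f p = c ∨ f p = d := by
  have hac' : a ≠ c := by rintro rfl; exact had hcd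
  have had' : a ≠ d := by rintro rfl; exact hac hcd.symm
  have hbd' : b ≠ d := by rintro rfl; exact had hab
  have hab' := hab.ne
  have hbc' := hbc.ne
  have hcd' := hcd.ne
  refine ⟨⟨⟨Sum.elim ![a, b, c, d] (fun q => q.1.elim0), ?_⟩, ?_⟩, ?_⟩
  · rintro (p | p) (q | q)
    · fin_cases p <;> fin_cases q <;> simp_all [eq_comm]
    · exact q.1.elim0
    · exact p.1.elim0
    · exact p.1.elim0
  · rintro (p | p) (q | q)
    · change G.Adj (![a, b, c, d] p) (![a, b, c, d] q) ↔ _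
      fin_cases p <;> fin_cases q <;>
        simp [p4kp3, pathGraph_adj, hab, hbc, hcd, hac, had, hbd, hab.symm, hbc.symm, hcd.symm,
          mt G.adj_symm hac, mt G.adj_symm had, mt G.adj_symm hbd]
    · exact q.1.elim0
    · exact p.1.elim0
    · exact p.1.elim0
  · rintro (p | p)
    · change ![a, b, c, d] p = a ∨ ![a, b, c, d] p = b ∨ ![a, b, c, d] p = c ∨ ![a, b, c, d] p = d
      fin_cases p <;> simp
    · exact p.1.elim0

theorem exists_embedding_p4kp3_succ {j : ℕ} (f : p4kp3 j ↪g G) {a b c : V} (hab : G.Adj a b)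
    (hbc : G.Adj b c) (hac : ¬ G.Adj a c) (hne : a ≠ c) (ha : ∀ p, ¬ G.Adj a (f p))
    (hb : ∀ p, ¬ G.Adj b (f p)) (hc : ∀ p, ¬ G.Adj c (f p)) :
    ∃ f' : p4kp3 (j + 1) ↪g G,
      ∀ p, (∃ q, f' p = f q) ∨ f' p = a ∨ f' p = b ∨ f' p = c := by
  have hout : ∀ v, (∀ p, ¬ G.Adj v (f p)) → ∀ p, f p ≠ v := by
    rintro v hv p rfl
    obtain ⟨q, hq⟩ := p4kp3_exists_adj j p
    exact hv q (f.map_rel_iff.2 hq)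
  let h : Fin 3 → V := ![a, b, c]
  have hh : ∀ t p, ¬ G.Adj (h t) (f p) := by
    intro t; fin_cases t; exacts [ha, hb, hc]
  have hh' : ∀ t p, ¬ G.Adj (f p) (h t) := fun t p e => hh t p e.symm
  have hn : ∀ t p, f p ≠ h t := fun t => hout _ (hh t)
  have hn' : ∀ t p, h t ≠ f p := fun t p e => hn t p e.symm
  have hinj : Function.Injective h := by
    intro s t
    fin_cases s <;> fin_cases t <;>
      simp [h, hab.ne, hbc.ne, hne, hab.ne.symm, hbc.ne.symm, hne.symm]
  have hadj : ∀ s t, G.Adj (h s) (h t) ↔ (pathGraph 3).Adj s t := by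
    intro s t
    fin_cases s <;> fin_cases t <;>
      simp [h, pathGraph_adj, hab, hbc, hac, hab.symm, hbc.symm, mt G.adj_symm hac]
  let g : Fin 4 ⊕ (Fin (j + 1) × Fin 3) → V :=
    Sum.elim (fun p => f (Sum.inl p))
      (fun q => Fin.lastCases (motive := fun _ => V) (h q.2) (fun i => f (Sum.inr (i, q.2))) q.1)
  have gl : ∀ p, g (Sum.inl p) = f (Sum.inl p) := fun _ => rfl
  have gr : ∀ i t, g (Sum.inr (Fin.castSucc i, t)) = f (Sum.inr (i, t)) := fun i t => by
    simp [g]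
  have gt : ∀ t, g (Sum.inr (Fin.last j, t)) = h t := fun t => by simp [g]
  have gadj : ∀ p q, G.Adj (g p) (g q) ↔ (p4kp3 (j + 1)).Adj p q := by
    rintro (p | ⟨i, p⟩) (q | ⟨l, q⟩)
    · simp [gl, p4kp3_adj_inl_inl]
    · cases l using Fin.lastCases <;> simp [gl, gr, gt, hh', not_p4kp3_adj_inl_inr]
    · cases i using Fin.lastCases <;> simp [gl, gr, gt, hh, not_p4kp3_adj_inr_inl]
    · have e1 : ∀ i : Fin j, Fin.last j ≠ i.castSucc := fun i => (Fin.castSucc_ne_last i).symm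
      cases i using Fin.lastCases <;> cases l using Fin.lastCases <;>
        simp [gr, gt, hh, hh', hadj, p4kp3_adj_inr_inr, e1]
  refine ⟨⟨⟨g, ?_⟩, gadj _ _⟩, ?_⟩
  · rintro (p | ⟨i, p⟩) (q | ⟨l, q⟩)
    · simp [gl]
    · cases l using Fin.lastCases <;> simp [gl, gr, gt, hn]
    · cases i using Fin.lastCases <;> simp [gl, gr, gt, hn']
    · cases i using Fin.lastCases <;> cases l using Fin.lastCases <;>
        simp [gr, gt, hn, hn', hinj.eq_iff]
  · rintro (p | ⟨i, p⟩)
    · exact Or.inl ⟨_, gl p⟩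
    · cases i using Fin.lastCases with
      | last =>
        right
        change g (Sum.inr (Fin.last j, p)) = a ∨ g (Sum.inr (Fin.last j, p)) = b ∨
          g (Sum.inr (Fin.last j, p)) = c
        rw [gt]
        fin_cases p <;> simp [h]
      | cast i => exact Or.inl ⟨_, gr i p⟩

/-- A `P4` together with pairwise anticomplete `P3`s, also anticomplete to it. -/
theorem exists_embedding_p4kp3_of_finset {ι : Type*} {a b c d : V} (hab : G.Adj a b)
    (hbc : G.Adj b c) (hcd : G.Adj c d) (hac : ¬ G.Adj a c) (had : ¬ G.Adj a d)
    (hbd : ¬ G.Adj b d) (J : Finset ι) (p : ι → Fin 3 → V)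
    (h01 : ∀ j ∈ J, G.Adj (p j 0) (p j 1)) (h12 : ∀ j ∈ J, G.Adj (p j 1) (p j 2))
    (h02 : ∀ j ∈ J, ¬ G.Adj (p j 0) (p j 2)) (hne : ∀ j ∈ J, p j 0 ≠ p j 2)
    (hP4 : ∀ j ∈ J, ∀ t v, v = a ∨ v = b ∨ v = c ∨ v = d → ¬ G.Adj (p j t) v)
    (hP3 : ∀ i ∈ J, ∀ j ∈ J, i ≠ j → ∀ s t, ¬ G.Adj (p i s) (p j t)) :
    Nonempty (p4kp3 J.card ↪g G) := by
  classical
  suffices h : ∀ K ⊆ J, ∃ f : p4kp3 K.card ↪g G, ∀ q,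
      (f q = a ∨ f q = b ∨ f q = c ∨ f q = d) ∨ ∃ j ∈ K, ∃ t, f q = p j t by
    exact ⟨(h J subset_rfl).choose⟩
  intro K
  induction K using Finset.induction_on with
  | empty =>
    intro _
    obtain ⟨f, hf⟩ := exists_embedding_p4kp3_zero hab hbc hcd hac had hbd
    exact ⟨f, fun q => Or.inl (hf q)⟩
  | insert i K hi ih =>
    intro hK
    obtain ⟨f, hf⟩ := ih fun j hj => hK (Finset.mem_insert_of_mem hj)
    have hiJ : i ∈ J := hK (Finset.mem_insert_self i K)
    have hanti : ∀ t q, ¬ G.Adj (p i t) (f q) := by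
      intro t q
      rcases hf q with hq | ⟨j, hj, s, hs⟩
      · exact hP4 i hiJ t _ hq
      · rw [hs]
        exact hP3 i hiJ j (hK (Finset.mem_insert_of_mem hj)) (by rintro rfl; exact hi hj) t s
    obtain ⟨f', hf'⟩ := exists_embedding_p4kp3_succ f (h01 i hiJ) (h12 i hiJ) (h02 i hiJ)
      (hne i hiJ) (hanti 0) (hanti 1) (hanti 2)
    rw [Finset.card_insert_of_notMem hi]
    refine ⟨f', fun q => ?_⟩
    rcases hf' q with ⟨r, hr⟩ | h | h | h
    · rw [hr]
      rcases hf r with h | ⟨j, hj, s, hs⟩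
      · exact Or.inl h
      · exact Or.inr ⟨j, Finset.mem_insert_of_mem hj, s, hs⟩
    · exact Or.inr ⟨i, Finset.mem_insert_self i K, 0, h⟩
    · exact Or.inr ⟨i, Finset.mem_insert_self i K, 1, h⟩
    · exact Or.inr ⟨i, Finset.mem_insert_self i K, 2, h⟩

end Embedding

section Exchange

variable {V ι : Type*} {x y x' y' : ι → V} {G : SimpleGraph V} {k : ℕ}
  {A C D S : Finset V} {E L : Finset ι}

/-- Every vertex of `C` has a neighbor in `S`. -/
def Covers (G : SimpleGraph V) (C S : Finset V) : Prop :=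
  ∀ c ∈ C, ∃ u ∈ S, G.Adj c u

/-- `c` is a vertex of `C` whose only neighbor in `S` is `z`, up to membership of `z` in `S`. -/
def IsPrivateIn (G : SimpleGraph V) (C S : Finset V) (z c : V) : Prop :=
  c ∈ C ∧ G.Adj c z ∧ ∀ u ∈ S, G.Adj c u → u = z

/-- Every edge `(x i, y i)`, `i ∈ L`, has both ends in `S`, and these have adjacent private
neighbors `x' i`, `y' i` in `C`; private neighbors of different edges are nonadjacent. -/
structure PrivateEdges (G : SimpleGraph V) (C S : Finset V) (L : Finset ι)
    (x y x' y' : ι → V) : Prop where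
  x_mem : ∀ i ∈ L, x i ∈ S
  y_mem : ∀ i ∈ L, y i ∈ S
  x_private : ∀ i ∈ L, IsPrivateIn G C S (x i) (x' i)
  y_private : ∀ i ∈ L, IsPrivateIn G C S (y i) (y' i)
  adj : ∀ i ∈ L, G.Adj (x' i) (y' i)
  cross : ∀ i ∈ L, ∀ j ∈ L, i ≠ j → ∀ p q, (p = x' i ∨ p = y' i) → (q = x' j ∨ q = y' j) →
    ¬ G.Adj p q

theorem PrivateEdges.exists_isPrivateIn (hp : PrivateEdges G C S L x y x' y') {i : ι}
    (hi : i ∈ L) {p : V} (hpi : p = x' i ∨ p = y' i) :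
    ∃ z, (z = x i ∨ z = y i) ∧ z ∈ S ∧ IsPrivateIn G C S z p := by
  rcases hpi with rfl | rfl
  · exact ⟨x i, Or.inl rfl, hp.x_mem i hi, hp.x_private i hi⟩
  · exact ⟨y i, Or.inr rfl, hp.y_mem i hi, hp.y_private i hi⟩

theorem PrivateEdges.mem (hp : PrivateEdges G C S L x y x' y') {i : ι}
    (hi : i ∈ L) {z : V} (hz : z = x i ∨ z = y i) : z ∈ S := by
  rcases hz with rfl | rfl
  · exact hp.x_mem i hi
  · exact hp.y_mem i hi

variable [DecidableEq V]

theorem Covers.exists_minimal {Q : Finset V} (hS : Covers G C S) (hQ : Q ⊆ S) :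
    ∃ S' ⊆ S, Q ⊆ S' ∧ Covers G C S' ∧ ∀ s ∈ S', s ∉ Q → ∃ c, IsPrivateIn G C S' s c := by
  obtain ⟨S', hS', hmin⟩ :=
    exists_minimal_le_of_wellFoundedLT (fun T => Q ⊆ T ∧ Covers G C T) S ⟨hQ, hS⟩
  refine ⟨S', hS', hmin.prop.1, hmin.prop.2, fun s hs hsQ => ?_⟩
  have hnot : ¬ Covers G C (S'.erase s) := by
    intro hc
    have hle := hmin.le_of_le (y := S'.erase s)
      ⟨fun q hq => Finset.mem_erase.2 ⟨by rintro rfl; exact hsQ hq, hmin.prop.1 hq⟩, hc⟩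
      (Finset.erase_subset s S')
    exact Finset.notMem_erase s S' (hle hs)
  unfold Covers at hnot
  push Not at hnot
  obtain ⟨c, hc, hcs⟩ := hnot
  have huniq : ∀ u ∈ S', G.Adj c u → u = s := by
    intro u hu hcu
    by_contra hne
    exact hcs u (Finset.mem_erase.2 ⟨hne, hu⟩) hcu
  obtain ⟨u, hu, hcu⟩ := hmin.prop.2 c hc
  exact ⟨c, hc, huniq u hu hcu ▸ hcu, huniq⟩

/-- A total dominating set `D` which is an induced matching, with a family `(x i, y i)`, `i ∈ E`,
of its edges avoiding `A` with `x i ∉ C`, and the optimality properties of `D`: adding `A` to a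
set covering `C` gives a set larger than `D`, and no total dominating set which is not larger than
`D` has fewer vertices outside `C`. -/
structure MatchingConfig (G : SimpleGraph V) (k : ℕ) (A C D : Finset V) (E : Finset ι)
    (x y : ι → V) : Prop where
  free : IndFree G (p4kp3 k)
  card_lt : ∀ S : Finset V, Covers G C S → D.card + 1 ≤ (S ∪ A).card
  covers : Covers G C (D \ A)
  exists_undominated : ∀ D' : Finset V, D'.card ≤ D.card → (D' \ C).card < (D \ C).card →
    ∃ v, ∀ u ∈ D', ¬ G.Adj v u
  total : ∀ v, ∃ u ∈ D, G.Adj v u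
  clique : ∀ a ∈ C, ∀ b ∈ C, ∀ c ∈ C, G.Adj a b → G.Adj b c → a ≠ c → G.Adj a c
  matching : ∀ a ∈ D, ∀ b ∈ D, ∀ c ∈ D, G.Adj a b → G.Adj a c → b = c
  x_mem : ∀ i ∈ E, x i ∈ D \ A
  y_mem : ∀ i ∈ E, y i ∈ D \ A
  x_notMem : ∀ i ∈ E, x i ∉ C
  adj : ∀ i ∈ E, G.Adj (x i) (y i)
  cross : ∀ i ∈ E, ∀ j ∈ E, i ≠ j → ∀ p q, (p = x i ∨ p = y i) → (q = x j ∨ q = y j) →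
    ¬ G.Adj p q

namespace MatchingConfig

theorem cross_ne (h : MatchingConfig G k A C D E x y) {i j : ι} (hi : i ∈ E) (hj : j ∈ E)
    (hij : i ≠ j) {p q : V} (hp : p = x i ∨ p = y i) (hq : q = x j ∨ q = y j) : p ≠ q := by
  rintro rfl
  rcases hq with rfl | rfl
  · exact h.cross i hi j hj hij _ _ hp (Or.inr rfl) (h.adj j hj)
  · exact h.cross i hi j hj hij _ _ hp (Or.inl rfl) (h.adj j hj).symm

theorem card_filter_add_one_le (h : MatchingConfig G k A C D E x y) (hS : Covers G C S) :
    (E.filter fun i => ¬ (x i ∈ S ∧ y i ∈ S)).card + 1 ≤ (S \ D).card + (A \ D).card := by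
  classical
  have hinj : (E.filter fun i => ¬ (x i ∈ S ∧ y i ∈ S)).card ≤ (D \ (S ∪ A)).card := by
    refine Finset.card_le_card_of_injOn (fun i => if x i ∈ S then y i else x i) ?_ ?_
    · intro i hi
      simp only [Finset.coe_filter, Set.mem_ofPred_eq] at hi
      obtain ⟨hi, hS⟩ := hi
      have hx := Finset.mem_sdiff.1 (h.x_mem i hi)
      have hy := Finset.mem_sdiff.1 (h.y_mem i hi)
      simp only [Finset.coe_sdiff, Set.mem_sdiff, Finset.mem_coe, Finset.mem_union]
      split_ifs with hxS <;> tauto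
    · intro i hi j hj hij
      simp only [Finset.coe_filter, Set.mem_ofPred_eq] at hi hj
      by_contra hne
      refine h.cross_ne hi.1 hj.1 hne ?_ ?_ hij
      · dsimp only; split_ifs <;> simp
      · dsimp only; split_ifs <;> simp
  have h1 := h.card_lt S hS
  have h2 := Finset.card_sdiff_add_card D (S ∪ A)
  have h3 := Finset.card_sdiff_add_card (S ∪ A) D
  have h4 : ((S ∪ A) \ D).card ≤ (S \ D).card + (A \ D).card := by
    rw [Finset.union_sdiff_distrib]
    exact Finset.card_union_le _ _
  rw [Finset.union_comm (S ∪ A) D] at h3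
  omega

/-- An induced `P4 + jP3` all of whose vertices lie in a covering set `S`, anticomplete to the
edges of the family inside `S` except for few of them, extends to an induced `P4 + kP3`. -/
theorem false_of_embedding (h : MatchingConfig G k A C D E x y)
    (hE : 2 * k + 2 + (A \ D).card ≤ E.card) (n : ℕ) :
    ∀ (j : ℕ) (_ : j + n = k) (f : p4kp3 j ↪g G) (S : Finset V) (U : Finset ι),
      Covers G C S → (∀ p, f p ∈ S) → U.card ≤ j + 2 → (S \ D).card ≤ j + 2 →
      (∀ i ∈ E, i ∉ U → x i ∈ S → y i ∈ S →
        ∀ z, z = x i ∨ z = y i → ∀ p, ¬ G.Adj z (f p)) → False := by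
  classical
  induction n with
  | zero =>
    rintro j rfl f - - - - - - -
    exact h.free ⟨f⟩
  | succ n ih =>
    intro j hj f S U hS hf hU hSD hinv
    obtain ⟨S', hS'S, hfS', hS', hpriv⟩ := hS.exists_minimal (Q := Finset.univ.image f)
      (by intro v hv; obtain ⟨p, -, rfl⟩ := Finset.mem_image.1 hv; exact hf p)
    have hfS'' : ∀ p, f p ∈ S' := fun p => hfS' (Finset.mem_image_of_mem _ (Finset.mem_univ p))
    have hSD' : (S' \ D).card ≤ j + 2 :=
      (Finset.card_le_card (Finset.sdiff_subset_sdiff hS'S subset_rfl)).trans hSD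
    obtain ⟨i, hi, hiU, hxi, hyi⟩ : ∃ i ∈ E, i ∉ U ∧ x i ∈ S' ∧ y i ∈ S' := by
      by_contra! hcon
      have hsub : E ⊆ (E.filter fun i => ¬ (x i ∈ S' ∧ y i ∈ S')) ∪ U := by
        intro i hi
        by_cases hiU : i ∈ U
        · exact Finset.mem_union_right _ hiU
        · exact Finset.mem_union_left _
            (Finset.mem_filter.2 ⟨hi, fun hxy => hcon i hi hiU hxy.1 hxy.2⟩)
      have h1 := (Finset.card_le_card hsub).trans (Finset.card_union_le _ _)
      have h2 := h.card_filter_add_one_le hS'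
      omega
    have hanti := hinv i hi hiU (hS'S hxi) (hS'S hyi)
    have hout : ∀ v, (∀ p, ¬ G.Adj v (f p)) → ∀ p, f p ≠ v := by
      rintro v hv p rfl
      obtain ⟨q, hq⟩ := p4kp3_exists_adj j p
      exact hv q (f.map_rel_iff.2 hq)
    obtain ⟨c, hcC, hcy, hc⟩ := hpriv (y i) hyi (by
      intro hm
      obtain ⟨p, -, hp⟩ := Finset.mem_image.1 hm
      exact hout _ (hanti _ (Or.inr rfl)) p hp)
    have hxc : x i ≠ c := by rintro rfl; exact h.x_notMem i hi hcC
    have hxc' : ¬ G.Adj (x i) c := fun e => (h.adj i hi).ne (hc _ hxi e.symm)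
    have hcf : ∀ p, ¬ G.Adj c (f p) := fun p e =>
      hout _ (hanti _ (Or.inr rfl)) p (hc _ (hfS'' p) e)
    obtain ⟨f', hf'⟩ := exists_embedding_p4kp3_succ f (h.adj i hi) hcy.symm hxc' hxc
      (hanti _ (Or.inl rfl)) (hanti _ (Or.inr rfl)) hcf
    refine ih (j + 1) (by omega) f' (insert c S') (insert i U) ?_ ?_ ?_ ?_ ?_
    · intro d hd
      obtain ⟨u, hu, hdu⟩ := hS' d hd
      exact ⟨u, Finset.mem_insert_of_mem hu, hdu⟩
    · intro p
      rcases hf' p with ⟨q, hq⟩ | hq | hq | hq <;> rw [hq]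
      · exact Finset.mem_insert_of_mem (hfS'' q)
      · exact Finset.mem_insert_of_mem hxi
      · exact Finset.mem_insert_of_mem hyi
      · exact Finset.mem_insert_self _ _
    · exact (Finset.card_insert_le _ _).trans (by omega)
    · have : insert c S' \ D ⊆ insert c (S' \ D) := by
        intro v hv
        simp only [Finset.mem_sdiff, Finset.mem_insert] at hv ⊢
        tauto
      exact (Finset.card_le_card this).trans ((Finset.card_insert_le _ _).trans (by omega))
    · intro l hl hlU hxl hyl z hz p
      rw [Finset.mem_insert, not_or] at hlU
      have hmem : ∀ z, z = x l ∨ z = y l → z ∈ insert c S' → z ∈ S' := by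
        intro z hz hzS
        rcases Finset.mem_insert.1 hzS with rfl | hzS
        · exact absurd hcy (h.cross l hl i hi hlU.1 _ _ hz (Or.inr rfl))
        · exact hzS
      have hxl' := hmem _ (Or.inl rfl) hxl
      have hyl' := hmem _ (Or.inr rfl) hyl
      have hzS : z ∈ S' := by rcases hz with rfl | rfl <;> assumption
      rcases hf' p with ⟨q, hq⟩ | hq | hq | hq <;> rw [hq]
      · exact hinv l hl hlU.2 (hS'S hxl') (hS'S hyl') z hz q
      · exact h.cross l hl i hi hlU.1 _ _ hz (Or.inl rfl)
      · exact h.cross l hl i hi hlU.1 _ _ hz (Or.inr rfl)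
      · intro e
        exact h.cross_ne hl hi hlU.1 hz (Or.inr rfl) (hc z hzS e.symm)

theorem false_of_path (h : MatchingConfig G k A C D E x y)
    (hE : 2 * k + 2 + (A \ D).card ≤ E.card) {a b c d : V} (hab : G.Adj a b)
    (hbc : G.Adj b c) (hcd : G.Adj c d) (hac : ¬ G.Adj a c) (had : ¬ G.Adj a d)
    (hbd : ¬ G.Adj b d) (hS : Covers G C S) (hSD : S ⊆ D) {u v : V} {U : Finset ι}
    (hU : U.card ≤ 2) (hmem : ∀ w, w = a ∨ w = b ∨ w = c ∨ w = d → w ∈ S ∨ w = u ∨ w = v)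
    (hanti : ∀ i ∈ E, i ∉ U → x i ∈ S → y i ∈ S → ∀ z, z = x i ∨ z = y i →
      ∀ w, w = a ∨ w = b ∨ w = c ∨ w = d → ¬ G.Adj z w)
    (huv : ∀ i ∈ E, i ∉ U → ∀ z, z = x i ∨ z = y i → z ≠ u ∧ z ≠ v) : False := by
  obtain ⟨f, hf⟩ := exists_embedding_p4kp3_zero hab hbc hcd hac had hbd
  refine h.false_of_embedding hE k 0 (by omega) f (insert u (insert v S)) U ?_ ?_ (by omega) ?_ ?_
  · intro t ht
    obtain ⟨w, hw, htw⟩ := hS t ht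
    exact ⟨w, Finset.mem_insert_of_mem (Finset.mem_insert_of_mem hw), htw⟩
  · intro p
    simp only [Finset.mem_insert]
    rcases hmem _ (hf p) with hp | hp | hp <;> tauto
  · have : insert u (insert v S) \ D ⊆ {u, v} := by
      intro w hw
      simp only [Finset.mem_sdiff, Finset.mem_insert, Finset.mem_singleton] at hw ⊢
      rcases hw.1 with hw' | hw' | hw'
      · exact Or.inl hw'
      · exact Or.inr hw'
      · exact absurd (hSD hw') hw.2
    exact (Finset.card_le_card this).trans (Finset.card_le_two.trans (by omega))
  · intro i hi hiU hxi hyi z hz p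
    have hin : ∀ z, z = x i ∨ z = y i → z ∈ insert u (insert v S) → z ∈ S := by
      intro z hz hzS
      have := huv i hi hiU z hz
      simp only [Finset.mem_insert] at hzS
      tauto
    exact hanti i hi hiU (hin _ (Or.inl rfl) hxi) (hin _ (Or.inr rfl) hyi) z hz _ (hf p)

theorem exists_adj_private (h : MatchingConfig G k A C D E x y)
    (hE : 2 * k + 2 + (A \ D).card ≤ E.card) (hS : Covers G C S) (hSD : S ⊆ D)
    (hmin : ∀ s ∈ S, ∃ c, IsPrivateIn G C S s c) {i : ι} (hi : i ∈ E) (hx : x i ∈ S)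
    (hy : y i ∈ S) :
    ∃ p q, IsPrivateIn G C S (x i) p ∧ IsPrivateIn G C S (y i) q ∧ G.Adj p q := by
  obtain ⟨q, hq⟩ := hmin _ hy
  by_cases hyC : y i ∈ C
  · exact ⟨y i, q, ⟨hyC, (h.adj i hi).symm, fun u hu hyu =>
      h.matching _ (hSD hy) _ (hSD hu) _ (hSD hx) hyu (h.adj i hi).symm⟩, hq, hq.2.1.symm⟩
  · obtain ⟨p, hp⟩ := hmin _ hx
    refine ⟨p, q, hp, hq, ?_⟩
    by_contra hpq
    have hne := (h.adj i hi).ne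
    refine h.false_of_path hE hp.2.1 (h.adj i hi) hq.2.1.symm
      (fun e => hne (hp.2.2 _ hy e).symm) hpq (fun e => hne (hq.2.2 _ hx e.symm)) hS hSD
      (u := p) (v := q) (U := {i}) (by simp) ?_ ?_ ?_
    · rintro w (rfl | rfl | rfl | rfl) <;> tauto
    · intro l hl hlU hxl hyl z hz w hw e
      rw [Finset.mem_singleton] at hlU
      have hzS : z ∈ S := by rcases hz with rfl | rfl <;> assumption
      rcases hw with rfl | rfl | rfl | rfl
      · exact h.cross_ne hl hi hlU hz (Or.inl rfl) (hp.2.2 z hzS e.symm)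
      · exact h.cross l hl i hi hlU _ _ hz (Or.inl rfl) e
      · exact h.cross l hl i hi hlU _ _ hz (Or.inr rfl) e
      · exact h.cross_ne hl hi hlU hz (Or.inr rfl) (hq.2.2 z hzS e.symm)
    · intro l hl hlU z hz
      rw [Finset.mem_singleton] at hlU
      constructor
      · rintro rfl
        exact h.cross l hl i hi hlU _ _ hz (Or.inl rfl) hp.2.1
      · rintro rfl
        exact h.cross l hl i hi hlU _ _ hz (Or.inr rfl) hq.2.1

theorem not_adj_private (h : MatchingConfig G k A C D E x y)
    (hE : 2 * k + 2 + (A \ D).card ≤ E.card) (hS : Covers G C S) (hSD : S ⊆ D) {i j : ι}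
    (hi : i ∈ E) (hj : j ∈ E) (hij : i ≠ j) (hxi : x i ∈ S) (hyi : y i ∈ S) {z t p q : V}
    (hz : z = x i ∨ z = y i) (ht : t = x j ∨ t = y j)
    (hp : IsPrivateIn G C S z p) (hq : IsPrivateIn G C S t q) : ¬ G.Adj p q := by
  classical
  intro hpq
  obtain ⟨w, hw, hwz, hwS⟩ : ∃ w, (w = x i ∨ w = y i) ∧ G.Adj w z ∧ w ∈ S := by
    rcases hz with rfl | rfl
    · exact ⟨y i, Or.inr rfl, (h.adj i hi).symm, hyi⟩
    · exact ⟨x i, Or.inl rfl, h.adj i hi, hxi⟩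
  have hzS : z ∈ S := by rcases hz with rfl | rfl <;> assumption
  refine h.false_of_path hE hwz hp.2.1.symm hpq (fun e => hwz.ne (hp.2.2 _ hwS e.symm))
    (fun e => h.cross_ne hi hj hij hw ht (hq.2.2 _ hwS e.symm))
    (fun e => h.cross_ne hi hj hij hz ht (hq.2.2 _ hzS e.symm)) hS hSD
    (u := p) (v := q) (U := {i, j}) Finset.card_le_two ?_ ?_ ?_
  · rintro w (rfl | rfl | rfl | rfl) <;> tauto
  · intro l hl hlU hxl hyl s hs r hr e
    rw [Finset.mem_insert, Finset.mem_singleton, not_or] at hlU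
    have hsS : s ∈ S := by rcases hs with rfl | rfl <;> assumption
    rcases hr with rfl | rfl | rfl | rfl
    · exact h.cross l hl i hi hlU.1 _ _ hs hw e
    · exact h.cross l hl i hi hlU.1 _ _ hs hz e
    · exact h.cross_ne hl hi hlU.1 hs hz (hp.2.2 s hsS e.symm)
    · exact h.cross_ne hl hj hlU.2 hs ht (hq.2.2 s hsS e.symm)
  · intro l hl hlU s hs
    rw [Finset.mem_insert, Finset.mem_singleton, not_or] at hlU
    constructor
    · rintro rfl
      exact h.cross l hl i hi hlU.1 _ _ hs hz hp.2.1
    · rintro rfl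
      exact h.cross l hl j hj hlU.2 _ _ hs ht hq.2.1

theorem exists_privateEdges (h : MatchingConfig G k A C D E x y)
    (hE : 2 * k + 2 + (A \ D).card ≤ E.card) :
    ∃ S ⊆ D \ A, ∃ L ⊆ E, ∃ x' y' : ι → V, Covers G C S ∧ E.card + 1 ≤ L.card + (A \ D).card ∧
      PrivateEdges G C S L x y x' y' := by
  classical
  obtain ⟨S, hSD, -, hS, hmin⟩ := h.covers.exists_minimal (Q := ∅) (Finset.empty_subset _)
  have hSD' : S ⊆ D := hSD.trans Finset.sdiff_subset
  have hpriv : ∀ i, ∃ p q, i ∈ E → x i ∈ S → y i ∈ S →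
      IsPrivateIn G C S (x i) p ∧ IsPrivateIn G C S (y i) q ∧ G.Adj p q := by
    intro i
    by_cases hi : i ∈ E ∧ x i ∈ S ∧ y i ∈ S
    · obtain ⟨p, q, hpq⟩ := h.exists_adj_private hE hS hSD'
        (fun s hs => hmin s hs (Finset.notMem_empty s)) hi.1 hi.2.1 hi.2.2
      exact ⟨p, q, fun _ _ _ => hpq⟩
    · exact ⟨x i, x i, fun h1 h2 h3 => absurd ⟨h1, h2, h3⟩ hi⟩
  choose x' y' hxy using hpriv
  have hL : ∀ i ∈ E.filter fun i => x i ∈ S ∧ y i ∈ S, i ∈ E ∧ x i ∈ S ∧ y i ∈ S :=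
    fun i hi => Finset.mem_filter.1 hi
  refine ⟨S, hSD, E.filter fun i => x i ∈ S ∧ y i ∈ S, Finset.filter_subset _ _, x', y', hS,
    ?_, fun i hi => (hL i hi).2.1, fun i hi => (hL i hi).2.2, fun i hi => ?_, fun i hi => ?_,
    fun i hi => ?_, ?_⟩
  · have h1 := h.card_filter_add_one_le hS
    have h2 := Finset.card_filter_add_card_filter_not (s := E) (fun i => x i ∈ S ∧ y i ∈ S)
    rw [Finset.sdiff_eq_empty_iff_subset.2 hSD', Finset.card_empty] at h1
    omega
  · obtain ⟨h1, h2, h3⟩ := hL i hi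
    exact (hxy i h1 h2 h3).1
  · obtain ⟨h1, h2, h3⟩ := hL i hi
    exact (hxy i h1 h2 h3).2.1
  · obtain ⟨h1, h2, h3⟩ := hL i hi
    exact (hxy i h1 h2 h3).2.2
  · intro i hi j hj hij p q hp hq
    obtain ⟨h1, h2, h3⟩ := hL i hi
    obtain ⟨g1, g2, g3⟩ := hL j hj
    obtain ⟨a1, a2, -⟩ := hxy i h1 h2 h3
    obtain ⟨b1, b2, -⟩ := hxy j g1 g2 g3
    rcases hp with rfl | rfl <;> rcases hq with rfl | rfl
    · exact h.not_adj_private hE hS hSD' h1 g1 hij h2 h3 (Or.inl rfl) (Or.inl rfl) a1 b1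
    · exact h.not_adj_private hE hS hSD' h1 g1 hij h2 h3 (Or.inl rfl) (Or.inr rfl) a1 b2
    · exact h.not_adj_private hE hS hSD' h1 g1 hij h2 h3 (Or.inr rfl) (Or.inl rfl) a2 b1
    · exact h.not_adj_private hE hS hSD' h1 g1 hij h2 h3 (Or.inr rfl) (Or.inr rfl) a2 b2

theorem private_not_adj (h : MatchingConfig G k A C D E x y)
    (hp : PrivateEdges G C S L x y x' y') (hL : L ⊆ E) {i j : ι} (hi : i ∈ L) (hj : j ∈ L)
    (hij : i ≠ j) {p z : V} (hpi : p = x' i ∨ p = y' i) (hz : z = x j ∨ z = y j) :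
    ¬ G.Adj p z := by
  intro e
  obtain ⟨t, ht, -, hpt⟩ := hp.exists_isPrivateIn hi hpi
  exact h.cross_ne (hL hi) (hL hj) hij ht hz (hpt.2.2 z (hp.mem hj hz) e).symm

theorem private_ne (h : MatchingConfig G k A C D E x y)
    (hp : PrivateEdges G C S L x y x' y') (hL : L ⊆ E) {i j : ι} (hi : i ∈ L) (hj : j ∈ L)
    (hij : i ≠ j) {p q : V} (hpi : p = x' i ∨ p = y' i) (hqj : q = x' j ∨ q = y' j) :
    p ≠ q := by
  rintro rfl
  obtain ⟨t, ht, -, hpt⟩ := hp.exists_isPrivateIn hj hqj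
  exact h.private_not_adj hp hL hi hj hij hpi ht hpt.2.1

/-- A vertex adjacent to an end of the edge `(x i, y i)` but to neither of its private neighbors
is adjacent to a vertex of all but fewer than `k` of the paths `x j, x' j, y' j`. -/
theorem card_lt_of_forall_not_adj (h : MatchingConfig G k A C D E x y)
    (hp : PrivateEdges G C S L x y x' y') (hL : L ⊆ E) {i : ι} (hi : i ∈ L) {v z : V}
    (hz : z = x i ∨ z = y i) (hvz : G.Adj v z) (hvx' : ¬ G.Adj v (x' i))
    (hvy' : ¬ G.Adj v (y' i)) {J : Finset ι} (hJ : J ⊆ L) (hiJ : i ∉ J)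
    (hJv : ∀ j ∈ J, ¬ G.Adj v (x j) ∧ ¬ G.Adj v (x' j) ∧ ¬ G.Adj v (y' j)) : J.card < k := by
  by_contra! hcard
  obtain ⟨K, hKJ, rfl⟩ := Finset.exists_subset_card_eq hcard
  obtain ⟨p, q, hpi, hqi, hpq, hzp, hzq, hvp, hvq⟩ : ∃ p q, (p = x' i ∨ p = y' i) ∧
      (q = x' i ∨ q = y' i) ∧ G.Adj p q ∧ G.Adj z p ∧ ¬ G.Adj z q ∧ ¬ G.Adj v p ∧
      ¬ G.Adj v q := by
    have hne := (h.adj i (hL hi)).ne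
    rcases hz with rfl | rfl
    · exact ⟨x' i, y' i, Or.inl rfl, Or.inr rfl, hp.adj i hi, (hp.x_private i hi).2.1.symm,
        fun e => hne ((hp.y_private i hi).2.2 _ (hp.x_mem i hi) e.symm), hvx', hvy'⟩
    · exact ⟨y' i, x' i, Or.inr rfl, Or.inl rfl, (hp.adj i hi).symm,
        (hp.y_private i hi).2.1.symm,
        fun e => hne ((hp.x_private i hi).2.2 _ (hp.y_mem i hi) e.symm).symm, hvy', hvx'⟩
  have hKL : ∀ j ∈ K, j ∈ L := fun j hj => hJ (hKJ hj)
  have hKi : ∀ j ∈ K, j ≠ i := by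
    rintro j hj rfl
    exact hiJ (hKJ hj)
  refine h.free (exists_embedding_p4kp3_of_finset hvz hzp hpq hvp hvq hzq K
    (fun j => ![x j, x' j, y' j]) (fun j hj => (hp.x_private j (hKL j hj)).2.1.symm)
    (fun j hj => hp.adj j (hKL j hj)) ?_ ?_ ?_ ?_)
  · intro j hj e
    exact (h.adj j (hL (hKL j hj))).ne
      ((hp.y_private j (hKL j hj)).2.2 _ (hp.x_mem j (hKL j hj)) e.symm)
  · intro j hj e
    exact h.x_notMem j (hL (hKL j hj))
      ((show x j = y' j from e) ▸ (hp.y_private j (hKL j hj)).1)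
  · intro j hj t w hw e
    have hjL := hKL j hj
    have hji := hKi j hj
    obtain ⟨h1, h2, h3⟩ := hJv j (hKJ hj)
    have hend : ∀ r, (r = x' j ∨ r = y' j) → ¬ G.Adj v r → ¬ G.Adj r w := by
      rintro r hr hvr hrw
      rcases hw with rfl | rfl | rfl | rfl
      · exact hvr hrw.symm
      · exact h.private_not_adj hp hL hjL hi hji hr hz hrw
      · exact hp.cross j hjL i hi hji _ _ hr hpi hrw
      · exact hp.cross j hjL i hi hji _ _ hr hqi hrw
    fin_cases t
    · rcases hw with rfl | rfl | rfl | rfl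
      · exact h1 e.symm
      · exact h.cross j (hL hjL) i (hL hi) hji _ _ (Or.inl rfl) hz e
      · exact h.private_not_adj hp hL hi hjL hji.symm hpi (Or.inl rfl) e.symm
      · exact h.private_not_adj hp hL hi hjL hji.symm hqi (Or.inl rfl) e.symm
    · exact hend _ (Or.inl rfl) h2 e
    · exact hend _ (Or.inr rfl) h3 e
  · intro l hl j hj hlj s t
    have hlL := hKL l hl
    have hjL := hKL j hj
    have hend : ∀ r, (r = x' l ∨ r = y' l) → ¬ G.Adj r (![x j, x' j, y' j] t) := by
      intro r hr
      fin_cases t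
      · exact h.private_not_adj hp hL hlL hjL hlj hr (Or.inl rfl)
      · exact hp.cross l hlL j hjL hlj _ _ hr (Or.inl rfl)
      · exact hp.cross l hlL j hjL hlj _ _ hr (Or.inr rfl)
    fin_cases s
    · fin_cases t
      · exact h.cross l (hL hlL) j (hL hjL) hlj _ _ (Or.inl rfl) (Or.inl rfl)
      · exact fun e => h.private_not_adj hp hL hjL hlL hlj.symm (Or.inl rfl) (Or.inl rfl) e.symm
      · exact fun e => h.private_not_adj hp hL hjL hlL hlj.symm (Or.inr rfl) (Or.inl rfl) e.symm
    · exact hend _ (Or.inl rfl)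
    · exact hend _ (Or.inr rfl)

theorem card_biUnion_ends (h : MatchingConfig G k A C D E x y) (hL : L ⊆ E) :
    (L.biUnion fun i => {x i, y i}).card = 2 * L.card := by
  rw [Finset.card_biUnion, Finset.sum_const_nat (m := 2), mul_comm]
  · intro i hi
    exact Finset.card_pair (h.adj i (hL hi)).ne
  · intro i hi j hj hij
    refine Finset.disjoint_left.2 fun v hv hv' => ?_
    simp only [Finset.mem_insert, Finset.mem_singleton] at hv hv'
    exact h.cross_ne (hL hi) (hL hj) hij hv hv' rfl

/-- Replacing the edges outside `T` by their private edges does not give a total dominating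
set. -/
theorem exists_undominated_exchange (h : MatchingConfig G k A C D E x y)
    (hp : PrivateEdges G C S L x y x' y') (hL : L ⊆ E) {T : Finset ι}
    (hTL : ∃ i ∈ L, i ∉ T) :
    ∃ v, ∃ i ∈ L, i ∉ T ∧ (∃ z, (z = x i ∨ z = y i) ∧ G.Adj v z) ∧ ¬ G.Adj v (x' i) ∧
      ¬ G.Adj v (y' i) ∧ ∀ j ∈ L, j ∈ T → ¬ G.Adj v (x j) := by
  classical
  set W := (L \ T).biUnion fun i => ({x i, y i} : Finset V) with hW
  set W' := (L \ T).biUnion fun i => ({x' i, y' i} : Finset V) with hW'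
  have hsub : L \ T ⊆ E := Finset.sdiff_subset.trans hL
  have hmemW : ∀ {u}, u ∈ W ↔ ∃ i, (i ∈ L ∧ i ∉ T) ∧ (u = x i ∨ u = y i) := by
    simp [hW]
  have hmemW' : ∀ {u}, u ∈ W' ↔ ∃ i, (i ∈ L ∧ i ∉ T) ∧ (u = x' i ∨ u = y' i) := by
    simp [hW']
  have hWD : W ⊆ D := by
    intro u hu
    obtain ⟨i, hi, rfl | rfl⟩ := hmemW.1 hu
    · exact (Finset.mem_sdiff.1 (h.x_mem i (hL hi.1))).1
    · exact (Finset.mem_sdiff.1 (h.y_mem i (hL hi.1))).1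
  have hWC : W' ⊆ C := by
    intro u hu
    obtain ⟨i, hi, rfl | rfl⟩ := hmemW'.1 hu
    · exact (hp.x_private i hi.1).1
    · exact (hp.y_private i hi.1).1
  obtain ⟨v, hv⟩ := h.exists_undominated ((D \ W) ∪ W') (by
    have h1 := Finset.card_union_le (D \ W) W'
    have h2 := Finset.card_sdiff_add_card_eq_card hWD
    have h3 : W.card = 2 * (L \ T).card := h.card_biUnion_ends hsub
    have h4 : W'.card ≤ (L \ T).card * 2 :=
      Finset.card_biUnion_le_card_mul _ _ _ fun i _ => Finset.card_le_two
    omega) (by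
    obtain ⟨i, hi, hiT⟩ := hTL
    refine Finset.card_lt_card (Finset.ssubset_iff_of_subset ?_ |>.2 ⟨x i, ?_, ?_⟩)
    · intro u hu
      simp only [Finset.mem_sdiff, Finset.mem_union] at hu ⊢
      rcases hu with ⟨hu | hu, huC⟩
      · exact ⟨hu.1, huC⟩
      · exact absurd (hWC hu) huC
    · exact Finset.mem_sdiff.2
        ⟨(Finset.mem_sdiff.1 (h.x_mem i (hL hi))).1, h.x_notMem i (hL hi)⟩
    · simp only [Finset.mem_sdiff, Finset.mem_union]
      rintro ⟨hu | hu, huC⟩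
      · exact hu.2 (hmemW.2 ⟨i, ⟨hi, hiT⟩, Or.inl rfl⟩)
      · exact huC (hWC hu))
  obtain ⟨u, hu, hvu⟩ := h.total v
  have huW : u ∈ W := by
    by_contra huW
    exact hv u (Finset.mem_union_left _ (Finset.mem_sdiff.2 ⟨hu, huW⟩)) hvu
  obtain ⟨i, hi, hui⟩ := hmemW.1 huW
  refine ⟨v, i, hi.1, hi.2, ⟨u, hui, hvu⟩, hv _ ?_, hv _ ?_, fun j hj hjT => hv _ ?_⟩
  · exact Finset.mem_union_right _ (hmemW'.2 ⟨i, hi, Or.inl rfl⟩)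
  · exact Finset.mem_union_right _ (hmemW'.2 ⟨i, hi, Or.inr rfl⟩)
  · refine Finset.mem_union_left _
      (Finset.mem_sdiff.2 ⟨(Finset.mem_sdiff.1 (h.x_mem j (hL hj))).1, fun hx => ?_⟩)
    obtain ⟨l, hl, hxl⟩ := hmemW.1 hx
    exact h.cross_ne (hL hj) (hL hl.1) (by rintro rfl; exact hl.2 hjT) (Or.inl rfl) hxl rfl

/-- Some `g` vertices dominate a private neighbor of each of `2g` edges of the family. -/
theorem exists_dominating_private (h : MatchingConfig G k A C D E x y)
    (hp : PrivateEdges G C S L x y x' y') (hL : L ⊆ E) (g : ℕ) (hg : 2 * g + k ≤ L.card) :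
    ∃ R ⊆ L, R.card = 2 * g ∧ ∃ W : Finset V, W.card ≤ g ∧
      ∀ j ∈ R, ∃ u, (u = x' j ∨ u = y' j) ∧ ∃ w ∈ W, G.Adj u w := by
  classical
  induction g with
  | zero => exact ⟨∅, by simp, by simp, ∅, by simp, by simp⟩
  | succ g ih =>
    obtain ⟨R, hRL, hR, W, hW, hRW⟩ := ih (by omega)
    have hLR := Finset.card_sdiff_add_card_eq_card hRL
    obtain ⟨T, hTL, hT⟩ := Finset.exists_subset_card_eq (show k + 1 ≤ (L \ R).card by omega)
    obtain ⟨v, i, hi, hiT, ⟨z, hz, hvz⟩, hvx', hvy', hvT⟩ := h.exists_undominated_exchange hp hL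
      (Finset.exists_mem_notMem_of_card_lt_card (show T.card < L.card by omega))
    have hTL' : ∀ j ∈ T, j ∈ L := fun j hj => (Finset.mem_sdiff.1 (hTL hj)).1
    have hlt := h.card_lt_of_forall_not_adj hp hL hi hz hvz hvx' hvy'
      (J := T.filter fun j => ¬ (G.Adj v (x' j) ∨ G.Adj v (y' j)))
      (fun j hj => hTL' j (Finset.mem_filter.1 hj).1)
      (fun hj => hiT (Finset.mem_filter.1 hj).1)
      (fun j hj => by
        obtain ⟨hj, hjv⟩ := Finset.mem_filter.1 hj
        rw [not_or] at hjv
        exact ⟨hvT j (hTL' j hj) hj, hjv⟩)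
    have hsum := Finset.card_filter_add_card_filter_not (s := T)
      (fun j => G.Adj v (x' j) ∨ G.Adj v (y' j))
    obtain ⟨Q, hQT, hQ⟩ := Finset.exists_subset_card_eq
      (show 2 ≤ (T.filter fun j => G.Adj v (x' j) ∨ G.Adj v (y' j)).card by omega)
    have hQ' : ∀ j ∈ Q, (j ∈ L ∧ j ∉ R) ∧ (G.Adj v (x' j) ∨ G.Adj v (y' j)) := fun j hj => by
      obtain ⟨hjT, hjv⟩ := Finset.mem_filter.1 (hQT hj)
      exact ⟨Finset.mem_sdiff.1 (hTL hjT), hjv⟩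
    refine ⟨R ∪ Q, Finset.union_subset hRL fun j hj => (hQ' j hj).1.1, ?_, insert v W,
      (Finset.card_insert_le _ _).trans (by omega), ?_⟩
    · rw [Finset.card_union_of_disjoint, hR, hQ]
      · ring
      · rw [Finset.disjoint_right]
        exact fun j hj => (hQ' j hj).1.2
    · intro j hj
      rcases Finset.mem_union.1 hj with hj | hj
      · obtain ⟨u, hu, w, hw, huw⟩ := hRW j hj
        exact ⟨u, hu, w, Finset.mem_insert_of_mem hw, huw⟩
      · rcases (hQ' j hj).2 with e | e
        · exact ⟨_, Or.inl rfl, v, Finset.mem_insert_self _ _, e.symm⟩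
        · exact ⟨_, Or.inr rfl, v, Finset.mem_insert_self _ _, e.symm⟩

theorem card_private_lt (h : MatchingConfig G k A C D E x y)
    (hp : PrivateEdges G C S L x y x' y') (hL : L ⊆ E) (hS : Covers G C S) (hSD : S ⊆ D) :
    L.card < 2 * A.card + k + 1 := by
  classical
  by_contra! hcard
  obtain ⟨R, hRL, hR, W, hW, hRW⟩ := h.exists_dominating_private hp hL A.card (by omega)
  have hu : ∀ j, ∃ u, j ∈ R → (u = x' j ∨ u = y' j) ∧ ∃ w ∈ W, G.Adj u w := by
    intro j
    by_cases hj : j ∈ R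
    · obtain ⟨u, hu⟩ := hRW j hj
      exact ⟨u, fun _ => hu⟩
    · exact ⟨x j, fun hj' => absurd hj' hj⟩
  choose u hu using hu
  have hC : ∀ j ∈ L, ∀ p, (p = x' j ∨ p = y' j) → p ∈ C := by
    rintro j hj p (rfl | rfl)
    · exact (hp.x_private j hj).1
    · exact (hp.y_private j hj).1
  set Q := R.biUnion fun i => ({x i, y i} : Finset V) with hQ
  have hmemQ : ∀ {u}, u ∈ Q ↔ ∃ i ∈ R, u = x i ∨ u = y i := by simp [hQ]
  have hQS : Q ⊆ S := by
    intro s hs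
    obtain ⟨i, hi, hsi⟩ := hmemQ.1 hs
    exact hp.mem (hRL hi) hsi
  have hQcard : Q.card = 2 * R.card := h.card_biUnion_ends (hRL.trans hL)
  have hcov : Covers G C ((S \ Q) ∪ (R.image u ∪ W)) := by
    intro c hc
    obtain ⟨s, hs, hcs⟩ := hS c hc
    by_cases hsQ : s ∈ Q
    swap
    · exact ⟨s, Finset.mem_union_left _ (Finset.mem_sdiff.2 ⟨hs, hsQ⟩), hcs⟩
    obtain ⟨j, hj, hsj⟩ := hmemQ.1 hsQ
    have hjL := hRL hj
    by_cases hcj : ∃ p, (p = x' j ∨ p = y' j) ∧ G.Adj c p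
    · obtain ⟨p, hpj, hcp⟩ := hcj
      obtain ⟨huj, w, hw, huw⟩ := hu j hj
      by_cases hcu : c = u j
      · exact ⟨w, Finset.mem_union_right _ (Finset.mem_union_right _ hw), hcu ▸ huw⟩
      refine ⟨u j, Finset.mem_union_right _
        (Finset.mem_union_left _ (Finset.mem_image_of_mem _ hj)), ?_⟩
      by_cases hpu : p = u j
      · exact hpu ▸ hcp
      · refine h.clique c hc p (hC j hjL p hpj) (u j) (hC j hjL _ huj) hcp ?_ hcu
        have := hp.adj j hjL
        rcases hpj with rfl | rfl <;> rcases huj with huj | huj <;> rw [huj] at hpu ⊢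
        · exact absurd rfl hpu
        · exact this
        · exact this.symm
        · exact absurd rfl hpu
    push Not at hcj
    have hLR := Finset.card_sdiff_add_card_eq_card hRL
    have hlt := h.card_lt_of_forall_not_adj hp hL hjL hsj hcs (hcj _ (Or.inl rfl))
      (hcj _ (Or.inr rfl))
      (J := (L \ R).filter fun l => ¬ (G.Adj c (x l) ∨ G.Adj c (x' l) ∨ G.Adj c (y' l)))
      (fun l hl => (Finset.mem_sdiff.1 (Finset.mem_filter.1 hl).1).1)
      (fun hl => (Finset.mem_sdiff.1 (Finset.mem_filter.1 hl).1).2 hj)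
      (fun l hl => by simpa only [not_or] using (Finset.mem_filter.1 hl).2)
    have hsum := Finset.card_filter_add_card_filter_not (s := L \ R)
      (fun l => G.Adj c (x l) ∨ G.Adj c (x' l) ∨ G.Adj c (y' l))
    obtain ⟨l₁, hl₁, l₂, hl₂, hne⟩ := Finset.one_lt_card.1
      (show 1 < ((L \ R).filter fun l =>
        G.Adj c (x l) ∨ G.Adj c (x' l) ∨ G.Adj c (y' l)).card by omega)
    have key : ∀ l ∈ (L \ R).filter fun l => G.Adj c (x l) ∨ G.Adj c (x' l) ∨ G.Adj c (y' l),
        l ∈ L ∧ ((∃ s ∈ (S \ Q) ∪ (R.image u ∪ W), G.Adj c s) ∨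
          ∃ p, (p = x' l ∨ p = y' l) ∧ G.Adj c p) := by
      intro l hl
      obtain ⟨hlR, hcl⟩ := Finset.mem_filter.1 hl
      obtain ⟨hlL, hlR⟩ := Finset.mem_sdiff.1 hlR
      refine ⟨hlL, ?_⟩
      rcases hcl with e | e | e
      · refine Or.inl ⟨x l, Finset.mem_union_left _
          (Finset.mem_sdiff.2 ⟨hp.x_mem l hlL, fun hx => ?_⟩), e⟩
        obtain ⟨i, hi, hxi⟩ := hmemQ.1 hx
        exact h.cross_ne (hL hlL) (hL (hRL hi)) (by rintro rfl; exact hlR hi) (Or.inl rfl) hxi rfl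
      · exact Or.inr ⟨_, Or.inl rfl, e⟩
      · exact Or.inr ⟨_, Or.inr rfl, e⟩
    obtain ⟨hlL₁, hdone | ⟨p₁, hp₁, hcp₁⟩⟩ := key l₁ hl₁
    · exact hdone
    obtain ⟨hlL₂, hdone | ⟨p₂, hp₂, hcp₂⟩⟩ := key l₂ hl₂
    · exact hdone
    exact absurd (h.clique p₁ (hC _ hlL₁ _ hp₁) c hc p₂ (hC _ hlL₂ _ hp₂) hcp₁.symm hcp₂
      (h.private_ne hp hL hlL₁ hlL₂ hne hp₁ hp₂)) (hp.cross _ hlL₁ _ hlL₂ hne _ _ hp₁ hp₂)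
  have h1 := h.card_lt _ hcov
  have h2 := Finset.card_union_le ((S \ Q) ∪ (R.image u ∪ W)) A
  have h3 := Finset.card_union_le (S \ Q) (R.image u ∪ W)
  have h4 := Finset.card_union_le (R.image u) W
  have h5 : (R.image u).card ≤ R.card := Finset.card_image_le
  have h6 := Finset.card_sdiff_add_card_eq_card hQS
  have h7 := Finset.card_le_card hSD
  omega

theorem card_edges_lt (h : MatchingConfig G k A C D E x y) (hk : 1 ≤ k) (hA : 1 ≤ A.card) :
    E.card < (k + 2) * (k + A.card) + (A \ D).card := by
  by_contra! hE
  obtain ⟨S, hSD, L, hL, x', y', hS, hcard, hp⟩ := h.exists_privateEdges (by nlinarith)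
  have := h.card_private_lt hp hL hS (hSD.trans Finset.sdiff_subset)
  nlinarith

end MatchingConfig

end Exchange

theorem totalDomNum_le {V : Type*} {G : SimpleGraph V} {D : Set V} (hD : IsTotalDomSet G D) :
    totalDomNum G ≤ D.ncard :=
  Nat.sInf_le ⟨D, hD, rfl⟩

theorem exists_isMinTotalDomSet {V : Type*} {G : SimpleGraph V} (hG : ∀ v, ∃ u, G.Adj v u) :
    ∃ D, IsMinTotalDomSet G D :=
  Nat.sInf_mem (s := {m : ℕ | ∃ D : Set V, IsTotalDomSet G D ∧ D.ncard = m})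
    ⟨_, Set.univ, fun v => let ⟨u, hu⟩ := hG v; ⟨u, Set.mem_univ u, hu⟩, rfl⟩

theorem eq_of_not_hasP3 {V : Type*} {G : SimpleGraph V} {D : Set V} (hD : ¬ HasP3 G D)
    {a b c : V} (ha : a ∈ D) (hb : b ∈ D) (hc : c ∈ D) (hab : G.Adj a b) (hac : G.Adj a c) :
    b = c := by
  by_contra hne
  exact hD ⟨b, a, c, hb, ha, hc, hab.ne.symm, hac.ne, hne, hab.symm, hac⟩

theorem hasP3_of_embedding {V : Type*} {G : SimpleGraph V} {S : Set V} {j : ℕ}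
    (f : p4kp3 j ↪g G) (hf : ∀ p, f p ∈ S) : HasP3 G S := by
  refine ⟨f (Sum.inl 0), f (Sum.inl 1), f (Sum.inl 2), hf _, hf _, hf _, ?_, ?_, ?_, ?_, ?_⟩
  · simp
  · simp
  · simp
  · exact f.map_rel_iff.2 (by simp [p4kp3_adj_inl_inl, pathGraph_adj])
  · exact f.map_rel_iff.2 (by simp [p4kp3_adj_inl_inl, pathGraph_adj])

theorem matchingConfig_of_isMinTotalDomSet {V : Type*} [DecidableEq V] {G : SimpleGraph V}
    {j : ℕ} (hfree : IndFree G (p4kp3 (j + 1))) {A C D : Finset V} (f : p4kp3 j ↪g G)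
    (hfA : ∀ v, v ∈ A ↔ ∃ p, f p = v) (hC : ∀ v, v ∈ C ↔ v ∉ A ∧ ∀ a ∈ A, ¬ G.Adj v a)
    (hnoP3 : ∀ D' : Set V, IsMinTotalDomSet G D' → ¬ HasP3 G D') (hD : IsMinTotalDomSet G D)
    (hmin : ∀ D' : Finset V, IsMinTotalDomSet G D' → (D \ C).card ≤ (D' \ C).card)
    {E : Finset (Sym2 V)} {x y : Sym2 V → V} (hE : ∀ e ∈ E, e = s(x e, y e))
    (hadj : ∀ e ∈ E, G.Adj (x e) (y e)) (hx : ∀ e ∈ E, x e ∈ D \ A)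
    (hy : ∀ e ∈ E, y e ∈ D \ A) (hxC : ∀ e ∈ E, x e ∉ C) :
    MatchingConfig G (j + 1) A C D E x y := by
  have hle : ∀ D' : Finset V, IsTotalDomSet G D' → D.card ≤ D'.card := fun D' hD' => by
    simpa [← hD.2] using totalDomNum_le hD'
  have hmk : ∀ D' : Finset V, IsTotalDomSet G D' → D'.card ≤ D.card → IsMinTotalDomSet G D' :=
    fun D' hD' hcard => ⟨hD', by
      rw [← hD.2, Set.ncard_coe_finset, Set.ncard_coe_finset]
      exact hcard.antisymm (hle D' hD')⟩
  have hmatch : ∀ a ∈ D, ∀ b ∈ D, ∀ c ∈ D, G.Adj a b → G.Adj a c → b = c :=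
    fun a ha b hb c hc => eq_of_not_hasP3 (hnoP3 _ hD) ha hb hc
  have hf : ∀ p, f p ∈ A := fun p => (hfA _).2 ⟨p, rfl⟩
  refine ⟨hfree, ?_, ?_, ?_, hD.1, ?_, hmatch, hx, hy, hxC, hadj, ?_⟩
  · intro S hS
    have htot : IsTotalDomSet G (S ∪ A : Finset V) := by
      intro v
      by_cases hvA : v ∈ A
      · obtain ⟨p, rfl⟩ := (hfA v).1 hvA
        obtain ⟨q, hq⟩ := p4kp3_exists_adj j p
        exact ⟨f q, Finset.mem_union_right _ (hf q), f.map_rel_iff.2 hq⟩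
      · by_cases hvC : v ∈ C
        · obtain ⟨u, hu, hvu⟩ := hS v hvC
          exact ⟨u, Finset.mem_union_left _ hu, hvu⟩
        · simp only [hC, hvA, not_false_eq_true, true_and, not_forall, not_not] at hvC
          obtain ⟨a, ha, hva⟩ := hvC
          exact ⟨a, Finset.mem_union_right _ ha, hva⟩
    by_contra! hlt
    exact hnoP3 _ (hmk _ htot (by omega))
      (hasP3_of_embedding f fun p => Finset.mem_union_right _ (hf p))
  · intro c hc
    obtain ⟨u, hu, hcu⟩ := hD.1 c
    exact ⟨u, Finset.mem_sdiff.2 ⟨hu, fun huA => ((hC c).1 hc).2 u huA hcu⟩, hcu⟩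
  · intro D' hcard hlt
    by_contra! htot
    exact hlt.not_ge (hmin D' (hmk D' htot hcard))
  · intro a ha b hb c hc hab hbc hac
    by_contra hnac
    have hanti : ∀ v ∈ C, ∀ p, ¬ G.Adj v (f p) := fun v hv p => ((hC v).1 hv).2 _ (hf p)
    obtain ⟨f', -⟩ := exists_embedding_p4kp3_succ f hab hbc hnac hac (hanti a ha) (hanti b hb)
      (hanti c hc)
    exact hfree ⟨f'⟩
  · intro e he e' he' hne p q hp hq hpq
    have hend : ∀ e ∈ E, ∀ p, (p = x e ∨ p = y e) →
        ∃ p', e = s(p, p') ∧ G.Adj p p' ∧ p ∈ D ∧ p' ∈ D := by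
      rintro e he p (rfl | rfl)
      · exact ⟨y e, hE e he, hadj e he, (Finset.mem_sdiff.1 (hx e he)).1,
          (Finset.mem_sdiff.1 (hy e he)).1⟩
      · exact ⟨x e, (hE e he).trans Sym2.eq_swap, (hadj e he).symm,
          (Finset.mem_sdiff.1 (hy e he)).1, (Finset.mem_sdiff.1 (hx e he)).1⟩
    obtain ⟨p', h1, hpp', hpD, hpD'⟩ := hend e he p hp
    obtain ⟨q', h2, hqq', hqD, hqD'⟩ := hend e' he' q hq
    obtain rfl := hmatch p hpD p' hpD' q hqD hpp' hpq
    obtain rfl := hmatch p' hqD q' hqD' p hpD hqq' hpq.symm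
    exact hne (h1.trans (Sym2.eq_swap.trans h2.symm))

theorem ncard_edges_lt {V : Type*} [Fintype V] {G : SimpleGraph V}
    {j : ℕ} (hfree : IndFree G (p4kp3 (j + 1))) {A C D : Finset V} (f : p4kp3 j ↪g G)
    (hfA : ∀ v, v ∈ A ↔ ∃ p, f p = v) (hC : ∀ v, v ∈ C ↔ v ∉ A ∧ ∀ a ∈ A, ¬ G.Adj v a)
    (hnoP3 : ∀ D' : Set V, IsMinTotalDomSet G D' → ¬ HasP3 G D') (hD : IsMinTotalDomSet G D)
    (hmin : ∀ D' : Finset V, IsMinTotalDomSet G D' →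
      ((D : Set V) \ C).ncard ≤ ((D' : Set V) \ C).ncard) :
    ({e : Sym2 V | ∃ x y : V, e = s(x, y) ∧ G.Adj x y ∧ x ∈ D ∧ y ∈ D ∧
      ¬ (x ∈ C ∧ y ∈ C)}).ncard < (j + 1 + 2) * (j + 1 + A.card) + A.card := by
  classical
  have hmatch : ∀ a ∈ D, ∀ b ∈ D, ∀ c ∈ D, G.Adj a b → G.Adj a c → b = c :=
    fun a ha b hb c hc => eq_of_not_hasP3 (hnoP3 _ hD) ha hb hc
  let E : Finset (Sym2 V) := Finset.univ.filter fun e =>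
    ∃ p q, e = s(p, q) ∧ G.Adj p q ∧ p ∈ D \ A ∧ q ∈ D \ A ∧ p ∉ C
  have hxy : ∀ e : Sym2 V, ∃ p q, e ∈ E →
      e = s(p, q) ∧ G.Adj p q ∧ p ∈ D \ A ∧ q ∈ D \ A ∧ p ∉ C := by
    intro e
    by_cases he : e ∈ E
    · obtain ⟨p, q, hpq⟩ := (Finset.mem_filter.1 he).2
      exact ⟨p, q, fun _ => hpq⟩
    · exact ⟨f (Sum.inl 0), f (Sum.inl 0), fun he' => absurd he' he⟩
  choose x y hxy using hxy
  have hcfg := matchingConfig_of_isMinTotalDomSet hfree f hfA hC hnoP3 hD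
    (fun D' hD' => by
      simpa only [← Finset.coe_sdiff, Set.ncard_coe_finset] using hmin D' hD')
    (E := E) (x := x) (y := y)
    (fun e he => (hxy e he).1) (fun e he => (hxy e he).2.1) (fun e he => (hxy e he).2.2.1)
    (fun e he => (hxy e he).2.2.2.1) (fun e he => (hxy e he).2.2.2.2)
  have hlt := hcfg.card_edges_lt (by omega)
    (Finset.card_pos.2 ⟨_, (hfA _).2 ⟨Sum.inl 0, rfl⟩⟩)
  choose m hmD hm using hD.1
  have hsub : {e : Sym2 V | ∃ x y : V, e = s(x, y) ∧ G.Adj x y ∧ x ∈ D ∧ y ∈ D ∧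
      ¬ (x ∈ C ∧ y ∈ C)} ⊆ (E ∪ (A ∩ D).image fun a => s(a, m a) : Finset (Sym2 V)) := by
    rintro e ⟨p, q, rfl, hpq, hp, hq, hpqC⟩
    rw [Finset.mem_coe, Finset.mem_union]
    by_cases hpA : p ∈ A
    · refine Or.inr (Finset.mem_image.2 ⟨p, Finset.mem_inter.2 ⟨hpA, hp⟩, ?_⟩)
      rw [hmatch p hp q hq (m p) (hmD p) hpq (hm p)]
    by_cases hqA : q ∈ A
    · refine Or.inr (Finset.mem_image.2 ⟨q, Finset.mem_inter.2 ⟨hqA, hq⟩, ?_⟩)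
      rw [hmatch q hq p hp (m q) (hmD q) hpq.symm (hm q), Sym2.eq_swap]
    refine Or.inl (Finset.mem_filter.2 ⟨Finset.mem_univ _, ?_⟩)
    have hp' := Finset.mem_sdiff.2 ⟨hp, hpA⟩
    have hq' := Finset.mem_sdiff.2 ⟨hq, hqA⟩
    by_cases hpC : p ∈ C
    · exact ⟨q, p, Sym2.eq_swap, hpq.symm, hq', hp', fun hqC => hpqC ⟨hpC, hqC⟩⟩
    · exact ⟨p, q, rfl, hpq, hp', hq', hpC⟩
  have h1 := Set.ncard_le_ncard hsub (Finset.finite_toSet _)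
  rw [Set.ncard_coe_finset] at h1
  have h2 := Finset.card_union_le E ((A ∩ D).image fun a => s(a, m a))
  have h3 : ((A ∩ D).image fun a => s(a, m a)).card ≤ (A ∩ D).card := Finset.card_image_le
  have h4 := Finset.card_inter_add_card_sdiff A D
  omega

end TD

theorem stmt15 {V : Type*} [Fintype V] (k : ℕ) (hk : 1 ≤ k)
    (G : SimpleGraph V) (hconn : G.Connected) (hfree : IndFree G (p4kp3 k))
    (A B C : Set V) (hA : Nonempty (G.induce A ≃g p4kp3 (k - 1)))
    (hB : B = {v | v ∉ A ∧ ∃ a ∈ A, G.Adj v a})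
    (hC : C = {v | v ∉ A ∧ v ∉ B})
    (hnoP3 : ∀ D' : Set V, IsMinTotalDomSet G D' → ¬ HasP3 G D') :
    (∀ D : Set V, IsMinTotalDomSet G D → ∀ v ∈ D, ∃! u : V, u ∈ D ∧ G.Adj v u) ∧
      ∃ D : Set V, IsMinTotalDomSet G D ∧
        ({e : Sym2 V | ∃ x y : V, e = s(x, y) ∧ G.Adj x y ∧ x ∈ D ∧ y ∈ D ∧
            ¬ (x ∈ C ∧ y ∈ C)}).ncard ≤ (k + 2) * (k + A.ncard) + A.ncard - 1 := by
  classical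
  obtain ⟨j, rfl⟩ := Nat.exists_eq_add_of_le' hk
  obtain ⟨φ⟩ := hA
  let f : p4kp3 j ↪g G := (SimpleGraph.Embedding.induce A).comp φ.symm.toEmbedding
  have hfA : ∀ v, v ∈ A ↔ ∃ p, f p = v := by
    refine fun v => ⟨fun hv => ⟨φ ⟨v, hv⟩, ?_⟩, ?_⟩
    · simp [f]
    · rintro ⟨p, rfl⟩
      exact (φ.symm p).2
  have hG : ∀ v, ∃ u, G.Adj v u := by
    have : Nontrivial V := ⟨f (Sum.inl 0), f (Sum.inl 1), by simp⟩
    exact fun v => hconn.preconnected.exists_adj_of_nontrivial v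
  refine ⟨fun D hD v hv => ?_, ?_⟩
  · obtain ⟨u, hu, hvu⟩ := hD.1 v
    exact ⟨u, ⟨hu, hvu⟩, fun w hw => eq_of_not_hasP3 (hnoP3 D hD) hv hw.1 hu hw.2 hvu⟩
  · obtain ⟨D, hD, hmin⟩ := Set.exists_min_image {D | IsMinTotalDomSet G D}
      (fun D => (D \ C).ncard) (Set.toFinite _) (exists_isMinTotalDomSet hG)
    refine ⟨D, hD, ?_⟩
    have hlt := ncard_edges_lt (A := A.toFinset) (C := C.toFinset) (D := D.toFinset) hfree f
      (by simpa using hfA) (by simp [hC, hB]; tauto) hnoP3 (by simpa using hD)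
      (fun D' hD' => by simpa using hmin D' hD')
    simp only [Set.mem_toFinset, ← Set.ncard_eq_toFinset_card'] at hlt
    omega
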